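/- Fix positive integers k and t with t < k ≤ 2t+1. There exist constants c₁, c₂ > 0 and n₀ such that for all n > n₀: c₁·n^t ≤ α(G(n,k,t)) ≤ c₂·n^t. -/

import Mathlib

/-- The independence number of the generalized Johnson graph `G(n,k,t)`:
the maximum size of a family of `k`-element subsets of `[n] = {1,…,n}`
containing no two distinct sets whose intersection has exactly `t` elements. -/
def alphaJ (n k t : ℕ) : ℕ :=
  ((((Finset.Icc 1 n).powersetCard k).powerset).filter
    (fun F => ∀ A ∈ F, ∀ B ∈ F, A ≠ B → (A ∩ B).card ≠ t)).sup Finset.card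

/-- **Frankl–Katona theorem**: a 0-1 matrix with more rows than columns has a nonempty set of rows
`S` with exactly `S.card - 1` common columns. -/
theorem exists_card_common_add_one_eq {α β : Type*} [DecidableEq α] [DecidableEq β]
    (C : α → Finset β) (N : Finset β) (M : Finset α) (h : N.card < M.card) :
    ∃ S ⊆ M, S.Nonempty ∧ (N.filter fun y => ∀ x ∈ S, y ∈ C x).card + 1 = S.card := by
  induction N using Finset.strongInduction generalizing M with
  | H N ih =>
  by_contra! hno
  have hrow : ∀ x ∈ M, 0 < (N.filter (· ∈ C x)).card := by
    intro x hx
    have := hno {x} (by simpa using hx) (by simp)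
    simp at this
    rw [Finset.card_pos]
    obtain ⟨y, hy⟩ := this
    exact ⟨y, by simpa using hy⟩
  have hdeg : ∀ x ∈ M, ∀ y ∈ N, y ∈ C x →
      (M.filter (y ∈ C ·)).card ≤ (N.filter (· ∈ C x)).card := by
    intro x hx y hy hyx
    by_contra! hlt
    have hyN : y ∈ N.filter (· ∈ C x) := by simp [hy, hyx]
    have hxM : x ∈ M.filter (y ∈ C ·) := by simp [hx, hyx]
    obtain ⟨S, hSM, hS, hcard⟩ := ih ((N.filter (· ∈ C x)).erase y)
      ((Finset.erase_ssubset hyN).trans_subset (Finset.filter_subset _ _))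
      ((M.filter (y ∈ C ·)).erase x) (by
        have := Finset.card_pos.2 ⟨y, hyN⟩
        rw [Finset.card_erase_of_mem hyN, Finset.card_erase_of_mem hxM]; omega)
    have hxS : x ∉ S := fun hh => by simpa using hSM hh
    refine hno (insert x S) ?_ (by simp) ?_
    · intro z hz
      rcases Finset.mem_insert.1 hz with rfl | hz
      · exact hx
      · exact (Finset.mem_filter.1 (Finset.mem_of_mem_erase (hSM hz))).1
    · rw [Finset.card_insert_of_notMem hxS, ← hcard]
      congr 1
      rw [← Finset.card_insert_of_notMem (a := y) (by simp)]
      congr 1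
      ext z
      simp only [Finset.mem_filter, Finset.mem_insert, Finset.mem_erase]
      constructor
      · rintro ⟨hz, hall⟩
        by_cases hzy : z = y
        · exact Or.inl hzy
        · exact Or.inr ⟨⟨hzy, hz, hall x (Or.inl rfl)⟩, fun w hw => hall w (Or.inr hw)⟩
      · rintro (rfl | ⟨⟨-, hz, hzx⟩, hall⟩)
        · refine ⟨hy, ?_⟩
          rintro w (rfl | hw)
          · exact hyx
          · exact (Finset.mem_filter.1 (Finset.mem_of_mem_erase (hSM hw))).2
        · refine ⟨hz, ?_⟩
          rintro w (rfl | hw)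
          · exact hzx
          · exact hall w hw
  have key : (M.card : ℚ) ≤ N.card := calc
    (M.card : ℚ) = ∑ x ∈ M, ∑ y ∈ N, if y ∈ C x then ((N.filter (· ∈ C x)).card : ℚ)⁻¹ else 0 := by
        rw [Finset.card_eq_sum_ones, Nat.cast_sum]
        refine Finset.sum_congr rfl fun x hx => ?_
        have := hrow x hx
        rw [← Finset.sum_filter, Finset.sum_const, nsmul_eq_mul, mul_inv_cancel₀ (by positivity)]
        simp
    _ ≤ ∑ x ∈ M, ∑ y ∈ N, if y ∈ C x then ((M.filter (y ∈ C ·)).card : ℚ)⁻¹ else 0 := by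
        refine Finset.sum_le_sum fun x hx => Finset.sum_le_sum fun y hy => ?_
        split_ifs with hyx
        · have h1 : 0 < (M.filter (y ∈ C ·)).card :=
            Finset.card_pos.2 ⟨x, by simp [hx, hyx]⟩
          have := hdeg x hx y hy hyx
          gcongr
        · rfl
    _ ≤ N.card := by
        rw [Finset.sum_comm, Finset.card_eq_sum_ones, Nat.cast_sum]
        refine Finset.sum_le_sum fun y hy => ?_
        rw [← Finset.sum_filter, Finset.sum_const, nsmul_eq_mul]
        simpa using mul_inv_le_one
  exact absurd (by exact_mod_cast key) h.not_ge

/-- In an intersection-closed family of proper subsets of a `k`-set with `k ≤ 2 * t + 1` and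
without members of size `t`, some `t`-subset is contained in no member. -/
theorem exists_uncovered_subset {α : Type*} [DecidableEq α] {k t : ℕ} (h1 : t < k)
    (h2 : k ≤ 2 * t + 1) {F : Finset α} (hF : F.card = k) {I : Finset α → Prop}
    (hsub : ∀ A, I A → A ⊂ F) (hinter : ∀ A B, I A → I B → I (A ∩ B))
    (hcard : ∀ A, I A → A.card ≠ t) :
    ∃ T ⊆ F, T.card = t ∧ ∀ A, I A → ¬ T ⊆ A := by
  classical
  by_contra! hcov
  obtain ⟨M, hM, hmin⟩ := Finset.exists_min_image
    (F.powerset.filter fun M => ∀ A, I A → ¬ M ⊆ A) Finset.card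
    ⟨F, by simpa using fun A hA => (hsub A hA).not_subset⟩
  simp only [Finset.mem_filter, Finset.mem_powerset] at hM hmin
  obtain ⟨hMF, hMI⟩ := hM
  have hMt : t + 1 ≤ M.card := by
    by_contra! hlt
    obtain ⟨T, hMT, hTF, hT⟩ := Finset.exists_subsuperset_card_eq hMF
      (show M.card ≤ t by omega) (by omega)
    obtain ⟨A, hA, hTA⟩ := hcov T hTF hT
    exact hMI A hA (hMT.trans hTA)
  obtain ⟨L, hLM, hL⟩ := Finset.exists_subset_card_eq hMt
  have hex : ∀ x ∈ M, ∃ A, I A ∧ M.erase x ⊆ A := by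
    intro x hx
    by_contra! hcon
    have := hmin (M.erase x) ⟨(Finset.erase_subset _ _).trans hMF, hcon⟩
    exact absurd (Finset.card_erase_lt_of_mem hx) this.not_gt
  choose! A hAI hAM using hex
  have hxA : ∀ x ∈ M, x ∉ A x := by
    intro x hx hxA
    refine hMI _ (hAI x hx) ?_
    rw [← Finset.insert_erase hx]
    exact Finset.insert_subset hxA (hAM x hx)
  have hLF := hLM.trans hMF
  obtain ⟨S, hSL, hS, hScard⟩ := exists_card_common_add_one_eq A (F \ L) L (by
    rw [Finset.card_sdiff_of_subset hLF]; omega)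
  refine hcard _ (Finset.inf'_induction (p := I) hS A (fun B hB C hC => hinter B C hB hC)
    fun x hx => hAI x (hLM (hSL hx))) ?_
  have hmem : ∀ y, y ∈ S.inf' hS A ↔ ∀ x ∈ S, y ∈ A x := by
    intro y
    rw [← Finset.singleton_subset_iff, Finset.le_inf'_iff]
    simp
  have heq : S.inf' hS A = (L \ S) ∪ (F \ L).filter (fun y => ∀ x ∈ S, y ∈ A x) := by
    ext y
    simp only [hmem, Finset.mem_union, Finset.mem_sdiff, Finset.mem_filter]
    constructor
    · intro hy
      obtain ⟨x, hx⟩ := hS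
      have hyF : y ∈ F := (hsub _ (hAI x (hLM (hSL hx)))).subset (hy x hx)
      by_cases hyL : y ∈ L
      · exact Or.inl ⟨hyL, fun hyS => hxA y (hLM hyL) (hy y hyS)⟩
      · exact Or.inr ⟨⟨hyF, hyL⟩, hy⟩
    · rintro (⟨hyL, hyS⟩ | ⟨-, hy⟩) x hx
      · exact hAM x (hLM (hSL hx)) (Finset.mem_erase.2 ⟨fun h => hyS (h ▸ hx), hLM hyL⟩)
      · exact hy x hx
  rw [heq, Finset.card_union_of_disjoint, Finset.card_sdiff_of_subset hSL]
  · have := Finset.card_le_card hSL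
    omega
  · rw [Finset.disjoint_left]
    intro y hy hy'
    simp only [Finset.mem_sdiff, Finset.mem_filter] at hy hy'
    exact hy'.1.2 hy.1

/-- `K` is the kernel of a sunflower with `s` petals in `G`. -/
def IsKernel {α : Type*} [DecidableEq α] (s : ℕ) (G : Finset (Finset α)) (K : Finset α) : Prop :=
  ∃ P ⊆ G, P.card = s ∧ (∀ A ∈ P, K ⊆ A) ∧ ∀ A ∈ P, ∀ B ∈ P, A ≠ B → A ∩ B = K

theorem IsKernel.mono {α : Type*} [DecidableEq α] {s : ℕ} {G H : Finset (Finset α)}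
    {K : Finset α} (h : IsKernel s G K) (hGH : G ⊆ H) : IsKernel s H K := by
  obtain ⟨P, hP, h⟩ := h
  exact ⟨P, hP.trans hGH, h⟩

/-- A sunflower with more than `B.card` petals has a petal meeting `B` inside the kernel only. -/
theorem IsKernel.exists_inter_eq {α : Type*} [DecidableEq α] {s : ℕ} {G : Finset (Finset α)}
    {K B : Finset α} (h : IsKernel s G K) (hB : B.card < s) :
    ∃ A ∈ G, K ⊆ A ∧ A ∩ B = K ∩ B := by
  obtain ⟨P, hPG, rfl, hKP, hP⟩ := h
  by_contra! hcon
  have hex : ∀ A ∈ P, ∃ y ∈ B, y ∈ A ∧ y ∉ K := by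
    intro A hA
    by_contra! hno
    refine hcon A (hPG hA) (hKP A hA) (Finset.Subset.antisymm ?_ ?_)
    · intro y hy
      rw [Finset.mem_inter] at hy ⊢
      exact ⟨hno y hy.2 hy.1, hy.2⟩
    · exact Finset.inter_subset_inter_right (hKP A hA)
  have : Nonempty α := by
    obtain ⟨A, hA⟩ := Finset.card_pos.1 (Nat.zero_lt_of_lt hB)
    exact ⟨(hex A hA).choose⟩
  choose! f hfB hfA hfK using hex
  obtain ⟨A, hA, A', hA', hne, heq⟩ := Finset.exists_ne_map_eq_of_card_lt_of_maps_to hB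
    (f := f) (fun A hA => hfB A hA)
  refine hfK A hA ?_
  rw [← hP A hA A' hA' hne, Finset.mem_inter]
  exact ⟨hfA A hA, heq ▸ hfA A' hA'⟩

theorem card_le_choose_of_forall_inter_isKernel {α : Type*} [DecidableEq α] {k t : ℕ}
    (h1 : t < k) (h2 : k ≤ 2 * t + 1) {V : Finset α} {G : Finset (Finset α)}
    (hG : ∀ A ∈ G, A ⊆ V ∧ A.card = k)
    (ht : ∀ A ∈ G, ∀ B ∈ G, A ≠ B → (A ∩ B).card ≠ t)
    (hker : ∀ A ∈ G, ∀ B ∈ G, A ≠ B → IsKernel (k + 1) G (A ∩ B)) :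
    G.card ≤ V.card.choose t := by
  have hne : ∀ A ∈ G, ∀ B ∈ G, A ≠ B → ¬ A ⊆ B := fun A hA B hB h hs =>
    h (Finset.eq_of_subset_of_card_le hs (by rw [(hG A hA).2, (hG B hB).2]))
  have hown : ∀ F ∈ G, ∃ T ⊆ F, T.card = t ∧ ∀ B ∈ G, F ≠ B → ¬ T ⊆ B := by
    intro F hF
    suffices h : ∃ T ⊆ F, T.card = t ∧ ∀ A, (∃ B ∈ G, F ≠ B ∧ F ∩ B = A) → ¬ T ⊆ A by
      obtain ⟨T, hTF, hT, hTI⟩ := h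
      refine ⟨T, hTF, hT, fun B hB hFB hTB => ?_⟩
      exact hTI _ ⟨B, hB, hFB, rfl⟩ (Finset.subset_inter hTF hTB)
    refine exists_uncovered_subset h1 h2 (hG F hF).2 ?_ ?_ ?_
    · rintro _ ⟨B, hB, hFB, rfl⟩
      exact ⟨Finset.inter_subset_left, fun h =>
        hne F hF B hB hFB (h.trans Finset.inter_subset_right)⟩
    · rintro _ _ ⟨B, hB, hFB, rfl⟩ ⟨C, hC, hFC, rfl⟩
      have hlt : ∀ X, (F ∩ X).card < k + 1 := fun X => by
        have := Finset.card_le_card (Finset.inter_subset_left (s₁ := F) (s₂ := X))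
        rw [(hG F hF).2] at this
        omega
      obtain ⟨X, hX, hBX, hXC⟩ := (hker F hF B hB hFB).exists_inter_eq (hlt C)
      obtain ⟨Y, hY, hCY, hYX⟩ := (hker F hF C hC hFC).exists_inter_eq
        (B := X) (by rw [(hG X hX).2]; omega)
      have hXY : X ∩ Y = F ∩ B ∩ (F ∩ C) := by
        rw [Finset.inter_comm, hYX, Finset.inter_comm, hXC]
      have hnot : ¬ F ⊆ F ∩ B ∩ (F ∩ C) := fun h =>
        hne F hF B hB hFB (h.trans (Finset.inter_subset_left.trans Finset.inter_subset_right))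
      have hneXY : X ≠ Y := by
        rintro rfl
        rw [Finset.inter_self] at hXY
        refine hnot (Finset.eq_of_subset_of_card_le (s := F ∩ B ∩ (F ∩ C)) (t := F) ?_ ?_).ge
        · exact Finset.inter_subset_left.trans Finset.inter_subset_left
        · rw [← hXY, (hG F hF).2, (hG X hX).2]
      obtain ⟨Z, hZ, hKZ, hZF⟩ := (hker X hX Y hY hneXY).exists_inter_eq
        (B := F) (by rw [(hG F hF).2]; omega)
      rw [hXY, Finset.inter_eq_left.2
        (Finset.inter_subset_left.trans Finset.inter_subset_left)] at hZF
      refine ⟨Z, hZ, ?_, by rw [Finset.inter_comm, hZF]⟩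
      rintro rfl
      rw [Finset.inter_self] at hZF
      exact hnot hZF.le
    · rintro _ ⟨B, hB, hFB, rfl⟩
      exact ht F hF B hB hFB
  choose! T hTF hT hTown using hown
  rw [← Finset.card_powersetCard]
  refine Finset.card_le_card_of_injOn T (fun F hF => ?_) fun F hF F' hF' h => ?_
  · exact Finset.mem_coe.2 (Finset.mem_powersetCard.2 ⟨(hTF F hF).trans (hG F hF).1, hT F hF⟩)
  · by_contra hFF
    exact hTown F hF F' hF' hFF (h ▸ hTF F' hF')

/-- If `K` is not the kernel of a sunflower with `s` petals among proper supersets of `K` of size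
at most `k`, then a positive proportion of them share an element outside `K`. -/
theorem exists_mem_card_le_mul_of_not_isKernel {α : Type*} [DecidableEq α] {s k : ℕ}
    {G : Finset (Finset α)} {K : Finset α} (hne : G.Nonempty) (hK : ∀ A ∈ G, K ⊂ A)
    (hk : ∀ A ∈ G, A.card ≤ k) (hG : ¬ IsKernel s G K) :
    ∃ v ∉ K, G.card ≤ s * k * (G.filter (v ∈ ·)).card := by
  classical
  obtain ⟨P, hP, hmax⟩ := Finset.exists_max_image
    (G.powerset.filter fun P => ∀ A ∈ P, ∀ B ∈ P, A ≠ B → A ∩ B = K) Finset.card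
    ⟨∅, by simp⟩
  simp only [Finset.mem_filter, Finset.mem_powerset] at hP hmax
  obtain ⟨hPG, hP⟩ := hP
  have hPs : P.card ≤ s := by
    by_contra! hlt
    obtain ⟨Q, hQP, hQ⟩ := Finset.exists_subset_card_eq hlt.le
    exact hG ⟨Q, hQP.trans hPG, hQ, fun A hA => (hK A (hPG (hQP hA))).subset,
      fun A hA B hB => hP A (hQP hA) B (hQP hB)⟩
  set W := P.biUnion (· \ K) with hW
  have hWcard : W.card ≤ s * k := by
    refine (Finset.card_biUnion_le_card_mul _ _ k fun A hA => ?_).trans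
      (Nat.mul_le_mul_right _ hPs)
    exact (Finset.card_le_card Finset.sdiff_subset).trans (hk A (hPG hA))
  have hmeet : ∀ A ∈ G, ∃ v ∈ W, v ∈ A := by
    intro A hA
    by_contra! hno
    have hdisj : ∀ B ∈ P, A ∩ B = K := by
      intro B hB
      refine Finset.Subset.antisymm (fun v hv => ?_)
        (Finset.subset_inter (hK A hA).subset (hK B (hPG hB)).subset)
      rw [Finset.mem_inter] at hv
      by_contra hvK
      exact hno v (Finset.mem_biUnion.2 ⟨B, hB, Finset.mem_sdiff.2 ⟨hv.2, hvK⟩⟩) hv.1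
    have hAP : A ∉ P := fun hAP => (hK A hA).ne' (by simpa using hdisj A hAP)
    have := hmax (insert A P) ⟨Finset.insert_subset hA hPG, ?_⟩
    · rw [Finset.card_insert_of_notMem hAP] at this
      omega
    · intro B hB C hC hBC
      rw [Finset.mem_insert] at hB hC
      rcases hB with rfl | hB <;> rcases hC with rfl | hC
      · exact absurd rfl hBC
      · exact hdisj C hC
      · rw [Finset.inter_comm]; exact hdisj B hB
      · exact hP B hB C hC hBC
  have hWne : W.Nonempty := by
    obtain ⟨A, hA⟩ := hne
    obtain ⟨v, hv, -⟩ := hmeet A hA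
    exact ⟨v, hv⟩
  obtain ⟨v, hv, hvmax⟩ := Finset.exists_max_image W (fun v => (G.filter (v ∈ ·)).card) hWne
  refine ⟨v, ?_, ?_⟩
  · obtain ⟨B, -, hvB⟩ := Finset.mem_biUnion.1 hv
    exact (Finset.mem_sdiff.1 hvB).2
  · calc G.card ≤ (W.biUnion fun w => G.filter (w ∈ ·)).card := by
          refine Finset.card_le_card fun A hA => ?_
          obtain ⟨w, hw, hwA⟩ := hmeet A hA
          exact Finset.mem_biUnion.2 ⟨w, hw, Finset.mem_filter.2 ⟨hA, hwA⟩⟩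
      _ ≤ W.card * (G.filter (v ∈ ·)).card := Finset.card_biUnion_le_card_mul _ _ _ hvmax
      _ ≤ _ := Nat.mul_le_mul_right _ hWcard

/-- The part of `F` whose colours lie in `J`. -/
def colorPart {α κ : Type*} [DecidableEq κ] (χ : α → κ) (J : Finset κ) (F : Finset α) : Finset α :=
  F.filter (χ · ∈ J)

/-- No two distinct members of `G` intersect in a set with colours `J`. -/
def IsOwn {α κ : Type*} [DecidableEq α] [DecidableEq κ] (χ : α → κ) (G : Finset (Finset α))
    (J : Finset κ) : Prop :=
  ∀ A ∈ G, ∀ B ∈ G, A ≠ B → (A ∩ B).image χ ≠ J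

theorem IsOwn.mono {α κ : Type*} [DecidableEq α] [DecidableEq κ] {χ : α → κ}
    {G H : Finset (Finset α)} {J : Finset κ} (h : IsOwn χ H J) (hGH : G ⊆ H) : IsOwn χ G J :=
  fun A hA B hB => h A (hGH hA) B (hGH hB)

theorem colorPart_image_inter {α κ : Type*} [DecidableEq α] [DecidableEq κ] {χ : α → κ}
    {A B : Finset α} (hA : Set.InjOn χ A) : colorPart χ ((A ∩ B).image χ) A = A ∩ B := by
  ext v
  simp only [colorPart, Finset.mem_filter, Finset.mem_image]
  constructor
  · rintro ⟨hv, w, hw, hwv⟩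
    have hwA := (Finset.mem_inter.1 hw).1
    rwa [← hA hwA hv hwv]
  · exact fun hv => ⟨(Finset.mem_inter.1 hv).1, v, hv, rfl⟩

theorem exists_isOwn_subfamily {α κ : Type*} [DecidableEq α] [DecidableEq κ] {χ : α → κ}
    {s k : ℕ} {D : Finset (Finset α)} {J : Finset κ} (hinj : ∀ A ∈ D, Set.InjOn χ A)
    (hk : ∀ A ∈ D, A.card ≤ k) (hJ : ∀ A ∈ D, ¬ A.image χ ⊆ J)
    (hD : ∀ E ⊆ D, E.Nonempty → ∃ A ∈ E, ¬ IsKernel s E (colorPart χ J A)) :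
    ∃ E ⊆ D, IsOwn χ E J ∧ D.card ≤ s * k * E.card := by
  classical
  have hex : ∀ K ∈ D.image (colorPart χ J), ∃ v ∉ K, (D.filter (colorPart χ J · = K)).card ≤
      s * k * ((D.filter (colorPart χ J · = K)).filter (v ∈ ·)).card := by
    intro K hK
    obtain ⟨A, hA, hAK⟩ := Finset.mem_image.1 hK
    have hne : (D.filter (colorPart χ J · = K)).Nonempty := ⟨A, Finset.mem_filter.2 ⟨hA, hAK⟩⟩
    obtain ⟨B, hB, hBK⟩ := hD _ (Finset.filter_subset _ _) hne
    rw [(Finset.mem_filter.1 hB).2] at hBK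
    refine exists_mem_card_le_mul_of_not_isKernel hne (fun C hC => ?_)
      (fun C hC => hk C (Finset.mem_filter.1 hC).1) hBK
    obtain ⟨hCD, rfl⟩ := Finset.mem_filter.1 hC
    refine ⟨Finset.filter_subset _ _, fun hle => hJ C hCD fun c hc => ?_⟩
    obtain ⟨v, hv, rfl⟩ := Finset.mem_image.1 hc
    exact (Finset.mem_filter.1 (hle hv)).2
  rcases D.eq_empty_or_nonempty with rfl | ⟨A₀, hA₀⟩
  · exact ⟨∅, by simp, by simp [IsOwn], by simp⟩
  have : Nonempty α := ⟨(hex _ (Finset.mem_image_of_mem _ hA₀)).choose⟩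
  choose! v hvK hv using hex
  refine ⟨D.filter fun A => v (colorPart χ J A) ∈ A, Finset.filter_subset _ _, ?_, ?_⟩
  · intro A hA B hB _ hAB
    rw [Finset.mem_filter] at hA hB
    have h1 : colorPart χ J A = A ∩ B := hAB ▸ colorPart_image_inter (hinj A hA.1)
    have h2 : colorPart χ J B = A ∩ B := by
      rw [← hAB, Finset.inter_comm]
      exact colorPart_image_inter (hinj B hB.1)
    refine hvK _ (Finset.mem_image_of_mem _ hA.1) ?_
    have hmem : v (colorPart χ J A) ∈ A ∩ B :=
      Finset.mem_inter.2 ⟨hA.2, by rw [h1, ← h2]; exact hB.2⟩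
    rwa [← h1] at hmem
  · rw [Finset.card_eq_sum_card_image (colorPart χ J) D, Finset.card_eq_sum_card_fiberwise
      (f := colorPart χ J) (t := D.image (colorPart χ J))
      (s := D.filter fun A => v (colorPart χ J A) ∈ A), Finset.mul_sum]
    · refine Finset.sum_le_sum fun K hK => (hv K hK).trans_eq ?_
      congr 2
      ext A
      simp only [Finset.mem_filter]
      constructor
      · rintro ⟨⟨h1, rfl⟩, h2⟩
        exact ⟨⟨h1, h2⟩, rfl⟩
      · rintro ⟨⟨h1, h2⟩, rfl⟩
        exact ⟨⟨h1, rfl⟩, h2⟩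
    · intro A hA
      exact Finset.mem_coe.2 (Finset.mem_image_of_mem _ (Finset.mem_filter.1 hA).1)

/-- Deleting members one at a time leaves a subfamily `G'` all of whose parts with colours in `𝒥`
are kernels; `D J` collects the members deleted because of `J`. -/
theorem exists_deletion_decomposition {α κ : Type*} [DecidableEq α] [DecidableEq κ] (χ : α → κ)
    (s : ℕ) (𝒥 : Finset (Finset κ)) (G : Finset (Finset α)) :
    ∃ (G' : Finset (Finset α)) (D : Finset κ → Finset (Finset α)), G' ⊆ G ∧
      (∀ A ∈ G', ∀ J ∈ 𝒥, IsKernel s G' (colorPart χ J A)) ∧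
      (∀ J ∈ 𝒥, D J ⊆ G ∧
        ∀ E ⊆ D J, E.Nonempty → ∃ A ∈ E, ¬ IsKernel s E (colorPart χ J A)) ∧
      G.card ≤ G'.card + ∑ J ∈ 𝒥, (D J).card := by
  induction G using Finset.strongInduction with
  | H G ih =>
  by_cases hgood : ∀ A ∈ G, ∀ J ∈ 𝒥, IsKernel s G (colorPart χ J A)
  · refine ⟨G, fun _ => ∅, subset_rfl, hgood, fun J _ => ⟨by simp, fun E hE hne => ?_⟩, by simp⟩
    simp [Finset.subset_empty.1 hE] at hne
  push Not at hgood
  obtain ⟨A, hA, J, hJ, hAJ⟩ := hgood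
  obtain ⟨G', D, hG', hker, hD, hcard⟩ := ih (G.erase A) (Finset.erase_ssubset hA)
  have hsub := Finset.erase_subset A G
  refine ⟨G', Function.update D J (insert A (D J)), hG'.trans hsub, hker, ?_, ?_⟩
  · intro J' hJ'
    rcases eq_or_ne J' J with rfl | hne
    · rw [Function.update_self]
      refine ⟨Finset.insert_subset hA ((hD _ hJ').1.trans hsub), fun E hE hEne => ?_⟩
      by_cases hAE : A ∈ E
      · exact ⟨A, hAE, fun h => hAJ (h.mono (hE.trans
          (Finset.insert_subset hA ((hD _ hJ').1.trans hsub))))⟩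
      · exact (hD _ hJ').2 E ((Finset.subset_insert_iff_of_notMem hAE).1 hE) hEne
    · rw [Function.update_of_ne hne]
      exact ⟨(hD _ hJ').1.trans hsub, (hD _ hJ').2⟩
  · have hAD : A ∉ D J := fun h => by simpa using (hD J hJ).1 h
    have h1 : ∑ J' ∈ 𝒥, (Function.update D J (insert A (D J)) J').card =
        ∑ J' ∈ 𝒥, ((D J').card + if J' = J then 1 else 0) := by
      refine Finset.sum_congr rfl fun J' _ => ?_
      rcases eq_or_ne J' J with rfl | hne
      · simp [hAD]
      · simp [hne]
    rw [h1, Finset.sum_add_distrib, Finset.sum_ite_eq' 𝒥 J, if_pos hJ]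
    rw [Finset.card_erase_of_mem hA] at hcard
    have := Finset.card_pos.2 ⟨A, hA⟩
    omega

theorem exists_subfamily_forall_inter_isKernel_aux {α κ : Type*} [DecidableEq α] [DecidableEq κ]
    [Fintype κ] {χ : α → κ} {s k : ℕ} (hs : 0 < s) (hk : 0 < k) (𝒥 : Finset (Finset κ))
    (hu : Finset.univ ∉ 𝒥) (G : Finset (Finset α)) (hown : ∀ J, J ∉ 𝒥 → IsOwn χ G J)
    (hinj : ∀ A ∈ G, Set.InjOn χ A) (huniv : ∀ A ∈ G, A.image χ = Finset.univ)
    (hcard : ∀ A ∈ G, A.card ≤ k) :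
    ∃ H ⊆ G, (∀ A ∈ H, ∀ B ∈ H, A ≠ B → IsKernel s H (A ∩ B)) ∧
      G.card ≤ (s * k * (2 ^ Fintype.card κ + 1)) ^ (𝒥.card + 1) * H.card := by
  induction 𝒥 using Finset.strongInduction generalizing G with
  | H 𝒥 ih =>
  set N := 2 ^ Fintype.card κ with hN
  set c := s * k * (N + 1) with hc
  have hsk : 1 ≤ s * k := Nat.one_le_iff_ne_zero.2 (by positivity)
  obtain ⟨G', D, hG', hker, hD, hsum⟩ := exists_deletion_decomposition χ s 𝒥 G
  have h𝒥N : 𝒥.card ≤ N := by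
    simpa [hN] using Finset.card_le_univ 𝒥
  by_cases hbig : G.card ≤ (N + 1) * G'.card
  · refine ⟨G', hG', fun A hA B hB hAB => ?_, hbig.trans (Nat.mul_le_mul_right _ ?_)⟩
    · rw [← colorPart_image_inter (hinj A (hG' hA))]
      refine hker A hA _ ?_
      by_contra hJ
      exact hown _ hJ A (hG' hA) B (hG' hB) hAB rfl
    · calc N + 1 ≤ c := Nat.le_mul_of_pos_left _ hsk
        _ ≤ c ^ (𝒥.card + 1) := Nat.le_self_pow (by omega) _
  · obtain ⟨J, hJ, hJbig⟩ : ∃ J ∈ 𝒥, G.card ≤ (N + 1) * (D J).card := by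
      by_contra! hno
      have h1 : (N + 1) * ∑ J ∈ 𝒥, (D J).card ≤ N * (G.card - 1) := by
        rw [Finset.mul_sum]
        calc ∑ J ∈ 𝒥, (N + 1) * (D J).card ≤ ∑ J ∈ 𝒥, (G.card - 1) :=
              Finset.sum_le_sum fun J hJ => by have := hno J hJ; omega
          _ = 𝒥.card * (G.card - 1) := by simp
          _ ≤ _ := Nat.mul_le_mul_right _ h𝒥N
      push Not at hbig
      have h2 : (N + 1) * G.card ≤ (N + 1) * G'.card + (N + 1) * ∑ J ∈ 𝒥, (D J).card := by
        rw [← mul_add]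
        exact Nat.mul_le_mul_left _ hsum
      have h3 : N * (G.card - 1) ≤ N * G.card := Nat.mul_le_mul_left _ (Nat.sub_le _ _)
      have h4 : (N + 1) * G.card = N * G.card + G.card := by ring
      omega
    have hDG := (hD J hJ).1
    obtain ⟨E, hED, hEown, hEcard⟩ := exists_isOwn_subfamily (fun A hA => hinj A (hDG hA))
      (fun A hA => hcard A (hDG hA)) (J := J) (fun A hA hle => hu (by
        rw [huniv A (hDG hA), Finset.univ_subset_iff] at hle
        exact hle ▸ hJ)) (hD J hJ).2
    have hEG := hED.trans hDG
    obtain ⟨H, hHE, hH, hHcard⟩ := ih (𝒥.erase J) (Finset.erase_ssubset hJ)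
      (fun h => hu (Finset.mem_of_mem_erase h)) E (fun J' hJ' => by
        by_cases hJJ : J' = J
        · exact hJJ ▸ hEown
        · exact (hown J' fun h => hJ' (Finset.mem_erase.2 ⟨hJJ, h⟩)).mono hEG)
      (fun A hA => hinj A (hEG hA)) (fun A hA => huniv A (hEG hA)) fun A hA => hcard A (hEG hA)
    rw [Finset.card_erase_add_one hJ] at hHcard
    refine ⟨H, hHE.trans hEG, hH, ?_⟩
    calc G.card ≤ (N + 1) * (D J).card := hJbig
      _ ≤ (N + 1) * (s * k * E.card) := Nat.mul_le_mul_left _ hEcard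
      _ = c * E.card := by rw [hc]; ring
      _ ≤ c * (c ^ 𝒥.card * H.card) := Nat.mul_le_mul_left _ hHcard
      _ = c ^ (𝒥.card + 1) * H.card := by ring

/-- **Füredi's theorem** on families all of whose intersections are kernels of sunflowers, for
families of rainbow sets. -/
theorem exists_subfamily_forall_inter_isKernel {α κ : Type*} [DecidableEq α] [DecidableEq κ]
    [Fintype κ] {χ : α → κ} {s k : ℕ} (hs : 0 < s) (hk : 0 < k) (G : Finset (Finset α))
    (hinj : ∀ A ∈ G, Set.InjOn χ A) (huniv : ∀ A ∈ G, A.image χ = Finset.univ)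
    (hcard : ∀ A ∈ G, A.card ≤ k) :
    ∃ H ⊆ G, (∀ A ∈ H, ∀ B ∈ H, A ≠ B → IsKernel s H (A ∩ B)) ∧
      G.card ≤ (s * k * (2 ^ Fintype.card κ + 1)) ^ (2 ^ Fintype.card κ) * H.card := by
  have h𝒥 : ((Finset.univ : Finset (Finset κ)).erase Finset.univ).card + 1 =
      2 ^ Fintype.card κ := by
    rw [Finset.card_erase_add_one (Finset.mem_univ _)]
    simp
  nth_rw 2 [← h𝒥]
  refine exists_subfamily_forall_inter_isKernel_aux hs hk _ (by simp) G ?_ hinj huniv hcard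
  intro J hJ A hA B hB hAB hABJ
  obtain rfl : J = Finset.univ := by simpa using hJ
  have hpart : ∀ C ∈ G, colorPart χ Finset.univ C = C := fun C _ => by simp [colorPart]
  have h1 := colorPart_image_inter (B := B) (hinj A hA)
  have h2 := colorPart_image_inter (B := A) (hinj B hB)
  rw [hABJ, hpart A hA] at h1
  rw [Finset.inter_comm, hABJ, hpart B hB] at h2
  exact hAB (h1.trans h2.symm)

theorem exists_coloring_card_le_mul {α : Type*} [DecidableEq α] {k : ℕ} (hk : 0 < k)
    (V : Finset α) (G : Finset (Finset α)) (hG : ∀ A ∈ G, A ⊆ V ∧ A.card = k) :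
    ∃ (χ : α → Fin k) (H : Finset (Finset α)), H ⊆ G ∧ (∀ A ∈ H, Set.InjOn χ A) ∧
      G.card ≤ k ^ k * H.card := by
  classical
  let ext (c : V → Fin k) (v : α) : Fin k := if h : v ∈ V then c ⟨v, h⟩ else ⟨0, hk⟩
  have hone : ∀ A ∈ G, k ^ V.card ≤
      k ^ k * ((Finset.univ : Finset (V → Fin k)).filter fun c => Set.InjOn (ext c) A).card := by
    intro A hA
    obtain ⟨hAV, hAk⟩ := hG A hA
    let e : A ≃ Fin k := A.equivFinOfCardEq hAk
    let r (c : V → Fin k) (v : V) : Fin k := if h : v.1 ∈ A then e ⟨v, h⟩ else c v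
    let p (c : V → Fin k) (v : A) : Fin k := c ⟨v, hAV v.2⟩
    calc k ^ V.card = (Finset.univ : Finset (V → Fin k)).card := by simp
      _ ≤ ((Finset.univ : Finset (A → Fin k)) ×ˢ
          (Finset.univ : Finset (V → Fin k)).filter fun c => Set.InjOn (ext c) A).card := by
        refine Finset.card_le_card_of_injOn (fun c => (p c, r c)) ?_ ?_
        · intro c _
          simp only [Finset.coe_product, Set.mem_prod, Finset.mem_coe, Finset.mem_univ,
            Finset.mem_filter, true_and]
          intro v hv w hw hvw
          rw [Finset.mem_coe] at hv hw
          simpa [ext, r, hAV hv, hAV hw, hv, hw] using hvw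
        · intro c _ c' _ h
          simp only [Prod.mk.injEq] at h
          funext v
          by_cases hv : v.1 ∈ A
          · exact congrFun h.1 ⟨v.1, hv⟩
          · simpa [r, hv] using congrFun h.2 v
      _ = _ := by rw [Finset.card_product]; simp [hAk]
  have : Nonempty (Fin k) := ⟨⟨0, hk⟩⟩
  obtain ⟨c, -, hc⟩ := Finset.exists_le_of_sum_le
    (s := (Finset.univ : Finset (V → Fin k))) (f := fun _ => G.card)
    (g := fun c => k ^ k * (G.filter fun A : Finset α => Set.InjOn (ext c) A).card)
    Finset.univ_nonempty (by
      calc ∑ c : V → Fin k, G.card = ∑ A ∈ G, k ^ V.card := by simp [mul_comm]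
        _ ≤ ∑ A ∈ G, k ^ k *
            ((Finset.univ : Finset (V → Fin k)).filter fun c => Set.InjOn (ext c) A).card :=
          Finset.sum_le_sum hone
        _ = _ := by
          simp only [Finset.card_filter, Finset.mul_sum]
          exact Finset.sum_comm)
  exact ⟨ext c, _, Finset.filter_subset _ _, fun A hA => (Finset.mem_filter.1 hA).2, hc⟩

/-- If `k ≤ 2 * t + 1`, a family of `k`-subsets of `V` avoiding intersections of size `t` has
`O(V.card ^ t)` members. -/
theorem card_le_of_forall_card_inter_ne {α : Type*} [DecidableEq α] {k t : ℕ} (h1 : t < k)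
    (h2 : k ≤ 2 * t + 1) {V : Finset α} {G : Finset (Finset α)}
    (hG : ∀ A ∈ G, A ⊆ V ∧ A.card = k)
    (ht : ∀ A ∈ G, ∀ B ∈ G, A ≠ B → (A ∩ B).card ≠ t) :
    G.card ≤ k ^ k * ((k + 1) * k * (2 ^ k + 1)) ^ 2 ^ k * V.card ^ t := by
  have hk : 0 < k := Nat.zero_lt_of_lt h1
  obtain ⟨χ, H, hHG, hinj, hGH⟩ := exists_coloring_card_le_mul hk V G hG
  obtain ⟨L, hLH, hker, hHL⟩ := exists_subfamily_forall_inter_isKernel (Nat.succ_pos k) hk H hinj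
    (fun A hA => Finset.eq_univ_of_card _ (by
      rw [Finset.card_image_of_injOn (hinj A hA), (hG A (hHG hA)).2, Fintype.card_fin]))
    (fun A hA => (hG A (hHG hA)).2.le)
  have hLG := hLH.trans hHG
  have hL := card_le_choose_of_forall_inter_isKernel h1 h2 (fun A hA => hG A (hLG hA))
    (fun A hA B hB => ht A (hLG hA) B (hLG hB)) hker
  rw [Fintype.card_fin] at hHL
  calc G.card ≤ k ^ k * H.card := hGH
    _ ≤ k ^ k * (((k + 1) * k * (2 ^ k + 1)) ^ 2 ^ k * V.card ^ t) :=
      Nat.mul_le_mul_left _ (hHL.trans (Nat.mul_le_mul_left _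
        (hL.trans (Nat.choose_le_pow _ _))))
    _ = _ := by ring

theorem card_filter_le_card_inter_le {α : Type*} [DecidableEq α] {k t : ℕ} (V A : Finset α)
    (hA : A.card = k) :
    ((V.powersetCard k).filter fun B => t ≤ (A ∩ B).card).card ≤ 2 ^ k * V.card ^ (k - t) := by
  calc ((V.powersetCard k).filter fun B => t ≤ (A ∩ B).card).card
      ≤ ((A.powersetCard t ×ˢ V.powersetCard (k - t)).image fun p => p.1 ∪ p.2).card := by
        refine Finset.card_le_card fun B hB => ?_
        rw [Finset.mem_filter, Finset.mem_powersetCard] at hB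
        obtain ⟨⟨hBV, hBk⟩, hAB⟩ := hB
        obtain ⟨T, hT, hTt⟩ := Finset.exists_subset_card_eq hAB
        have hTB := hT.trans Finset.inter_subset_right
        refine Finset.mem_image.2 ⟨(T, B \ T), ?_, Finset.union_sdiff_of_subset hTB⟩
        rw [Finset.mem_product, Finset.mem_powersetCard, Finset.mem_powersetCard]
        exact ⟨⟨hT.trans Finset.inter_subset_left, hTt⟩, Finset.sdiff_subset.trans hBV, by
          rw [Finset.card_sdiff_of_subset hTB, hBk, hTt]⟩
    _ ≤ k.choose t * V.card.choose (k - t) := by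
        refine Finset.card_image_le.trans_eq ?_
        rw [Finset.card_product, Finset.card_powersetCard, Finset.card_powersetCard, hA]
    _ ≤ 2 ^ k * V.card ^ (k - t) :=
        Nat.mul_le_mul (Nat.choose_le_two_pow _ _) (Nat.choose_le_pow _ _)

theorem choose_le_alphaJ_mul {k t : ℕ} (h1 : t < k) (n : ℕ) :
    n.choose k ≤ alphaJ n k t * (2 ^ k * n ^ (k - t)) := by
  obtain ⟨P, hP, hPcard⟩ := Finset.exists_mem_eq_sup
    ((((Finset.Icc 1 n).powersetCard k).powerset).filter
      (fun F => ∀ A ∈ F, ∀ B ∈ F, A ≠ B → (A ∩ B).card ≠ t)) ⟨∅, by simp⟩ Finset.card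
  have hle : ∀ Q ∈ (((Finset.Icc 1 n).powersetCard k).powerset).filter
      (fun F => ∀ A ∈ F, ∀ B ∈ F, A ≠ B → (A ∩ B).card ≠ t), Q.card ≤ P.card := fun Q hQ =>
    hPcard ▸ Finset.le_sup (f := Finset.card) hQ
  have halpha : alphaJ n k t = P.card := hPcard
  simp only [Finset.mem_filter, Finset.mem_powerset] at hP hle
  obtain ⟨hPV, hPt⟩ := hP
  have hcover : ∀ B ∈ (Finset.Icc 1 n).powersetCard k, ∃ A ∈ P, t ≤ (A ∩ B).card := by
    intro B hB
    by_contra! hno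
    have hBP : B ∉ P := fun h => by
      have := hno B h
      rw [Finset.inter_self, (Finset.mem_powersetCard.1 hB).2] at this
      omega
    have := hle (insert B P) ⟨Finset.insert_subset hB hPV, ?_⟩
    · rw [Finset.card_insert_of_notMem hBP] at this
      omega
    · intro X hX Y hY hXY
      rw [Finset.mem_insert] at hX hY
      rcases hX with rfl | hX <;> rcases hY with rfl | hY
      · exact absurd rfl hXY
      · rw [Finset.inter_comm]; exact (hno Y hY).ne
      · exact (hno X hX).ne
      · exact hPt X hX Y hY hXY
  rw [halpha]
  calc n.choose k = ((Finset.Icc 1 n).powersetCard k).card := by simp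
    _ ≤ (P.biUnion fun A =>
        ((Finset.Icc 1 n).powersetCard k).filter fun B => t ≤ (A ∩ B).card).card := by
      refine Finset.card_le_card fun B hB => ?_
      obtain ⟨A, hA, hAB⟩ := hcover B hB
      exact Finset.mem_biUnion.2 ⟨A, hA, Finset.mem_filter.2 ⟨hB, hAB⟩⟩
    _ ≤ _ := Finset.card_biUnion_le_card_mul _ _ _ fun A hA => by
      simpa using card_filter_le_card_inter_le (t := t) (Finset.Icc 1 n) A
        (Finset.mem_powersetCard.1 (hPV hA)).2

theorem pow_le_mul_alphaJ {n k t : ℕ} (h1 : t < k) (hn : 2 * k < n) :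
    n ^ t ≤ 4 ^ k * k.factorial * alphaJ n k t := by
  have h : n ^ t * n ^ (k - t) ≤ 4 ^ k * k.factorial * alphaJ n k t * n ^ (k - t) := calc
    n ^ t * n ^ (k - t) = n ^ k := by rw [← pow_add, Nat.add_sub_cancel' h1.le]
    _ ≤ (2 * (n + 1 - k)) ^ k := Nat.pow_le_pow_left (by omega) _
    _ = 2 ^ k * (n + 1 - k) ^ k := mul_pow _ _ _
    _ ≤ 2 ^ k * n.descFactorial k := Nat.mul_le_mul_left _ (Nat.pow_sub_le_descFactorial _ _)
    _ = 2 ^ k * k.factorial * n.choose k := by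
      rw [Nat.descFactorial_eq_factorial_mul_choose, mul_assoc]
    _ ≤ 2 ^ k * k.factorial * (alphaJ n k t * (2 ^ k * n ^ (k - t))) :=
      Nat.mul_le_mul_left _ (choose_le_alphaJ_mul h1 n)
    _ = 4 ^ k * k.factorial * alphaJ n k t * n ^ (k - t) := by
      rw [show 4 = 2 * 2 from rfl, mul_pow]
      ring
  exact Nat.le_of_mul_le_mul_right h (Nat.pow_pos (by omega))

/-- Frankl–Füredi: for `t < k ≤ 2t+1`, `α(G(n,k,t)) = Θ(n^t)`. -/
theorem frankl_furedi_small_k (k t : ℕ) (ht : 0 < t) (h1 : t < k) (h2 : k ≤ 2 * t + 1) :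
    ∃ c₁ c₂ : ℝ, 0 < c₁ ∧ 0 < c₂ ∧ ∃ n₀ : ℕ, ∀ n > n₀,
      c₁ * (n : ℝ) ^ t ≤ (alphaJ n k t : ℝ) ∧ (alphaJ n k t : ℝ) ≤ c₂ * (n : ℝ) ^ t := by
  have hk : 0 < k := ht.trans h1
  refine ⟨((4 ^ k * k.factorial : ℕ) : ℝ)⁻¹,
    ((k ^ k * ((k + 1) * k * (2 ^ k + 1)) ^ 2 ^ k : ℕ) : ℝ), by positivity, by positivity, 2 * k,
    fun n hn => ⟨?_, ?_⟩⟩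
  · rw [inv_mul_le_iff₀ (by positivity)]
    exact_mod_cast pow_le_mul_alphaJ h1 hn
  · suffices h : alphaJ n k t ≤ k ^ k * ((k + 1) * k * (2 ^ k + 1)) ^ 2 ^ k * n ^ t by
      exact_mod_cast h
    refine Finset.sup_le fun G hG => ?_
    rw [Finset.mem_filter, Finset.mem_powerset] at hG
    simpa using card_le_of_forall_card_inter_ne h1 h2 (V := Finset.Icc 1 n)
      (fun A hA => Finset.mem_powersetCard.1 (hG.1 hA)) hG.2
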